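/- arXiv:1704.00319 — 2 statements merged into one kernel-verified Lean document; each statement's English description precedes it below -/
import Mathlib

section
/- Let 1 < p < ∞, N ≥ n, and let x = (x_1,…,x_n) be an n-tuple in ℓ_p^N with Property K. Then there is δ > 0 such that whenever E is an N-dimensional Banach space admitting a linear isomorphism T : ℓ_p^N → E with ‖T‖·‖T^{-1}‖ < 1 + δ, the metric space {x_1,…,x_n} with the metric inherited from ℓ_p^N embeds isometrically into E. -/
open MeasureTheory
open scoped ENNReal
noncomputable section

/-- The index set of pairs `(i,j)` with `i < j`, indexing the coordinates of
`ℝ^{n(n-1)/2}`. -/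
abbrev PairIdx (n : ℕ) := {q : Fin n × Fin n // q.1 < q.2}

/-- `‖v‖_p` for `v ∈ ℝ^n`. -/
def pNorm (p : ℝ) {n : ℕ} (v : Fin n → ℝ) : ℝ := (∑ k, |v k| ^ p) ^ (1 / p)

/-- The map `F_n : (ℝ^n)^n → ℝ^{n(n-1)/2}`, `F_n(x₁,…,xₙ) = (‖x_i - x_j‖_p^p)_{i<j}`. -/
def Fmap (p : ℝ) (n : ℕ) (x : Fin n → Fin n → ℝ) : PairIdx n → ℝ :=
  fun q => ∑ k, |x q.val.1 k - x q.val.2 k| ^ p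

/-- `G_n`: the set of points of `(ℝ^n)^n` where the derivative of `F_n` has full rank
`n(n-1)/2`. -/
def Gset (p : ℝ) (n : ℕ) : Set (Fin n → Fin n → ℝ) :=
  {x | LinearMap.rank (fderiv ℝ (Fmap p n) x).toLinearMap = ((n * (n - 1) / 2 : ℕ) : Cardinal)}

/-- Property K for an `n`-tuple of points of `ℓ_p` (given by their coordinates). -/
def PropertyKSeq (p : ℝ) (n : ℕ) (x : Fin n → ℕ → ℝ) : Prop :=
  ∃ m : Fin n → ℕ, StrictMono m ∧ (fun i j => x i (m j)) ∈ Gset p n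

/-- Property K for an `n`-tuple of points of `ℓ_p^N`. -/
def PropertyKFin (p : ℝ) (n N : ℕ) (x : Fin n → Fin N → ℝ) : Prop :=
  ∃ m : Fin n → Fin N, StrictMono m ∧ (fun i j => x i (m j)) ∈ Gset p n

/-- A Borel set `A` in a (separable) Banach space is Haar null if there is a Borel
probability measure `μ` with `μ(x + A) = 0` for all `x`. -/
def HaarNull {X : Type*} [AddGroup X] [MeasurableSpace X] (A : Set X) : Prop :=
  ∃ μ : Measure X, IsProbabilityMeasure μ ∧ ∀ x : X, μ ((fun a => x + a) '' A) = 0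

/-- `X` uniformly contains the spaces `ℓ_p^m`, `m ∈ ℕ`. -/
def UnifContainsLp (p : ℝ≥0∞) [Fact (1 ≤ p)] (X : Type*) [NormedAddCommGroup X]
    [NormedSpace ℝ X] : Prop :=
  ∃ C : ℝ, 1 ≤ C ∧ ∀ m : ℕ, ∃ (Y : Submodule ℝ X)
    (T : PiLp p (fun _ : Fin m => ℝ) ≃L[ℝ] Y),
      ‖(T : PiLp p (fun _ : Fin m => ℝ) →L[ℝ] Y)‖ *
        ‖(T.symm : Y →L[ℝ] PiLp p (fun _ : Fin m => ℝ))‖ ≤ C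

-- test lp coercion and instances

/-- A convex function uniformly close to an approximately linear one has increments close to those
of the same linear functional. -/
theorem ConvexOn.sub_sub_le_of_forall_abs_sub_le {V : Type*} [NormedAddCommGroup V]
    [NormedSpace ℝ V] {f g : V → ℝ} {A : V →L[ℝ] ℝ} {b : V} {r c ε : ℝ} (hr : 0 < r)
    (hf : ∀ u ∈ Metric.closedBall b (2 * r), ∀ v ∈ Metric.closedBall b (2 * r),
      |f u - f v - A (u - v)| ≤ c * ‖u - v‖)
    (hg : ConvexOn ℝ Set.univ g)
    (hfg : ∀ u ∈ Metric.closedBall b (2 * r), |g u - f u| ≤ ε)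
    {u v : V} (hu : u ∈ Metric.closedBall b r) :
    g u - g v - A (u - v) ≤ (c + 2 * ε / r) * ‖u - v‖ := by
  rcases eq_or_ne u v with rfl | huv
  · simp
  have hd : 0 < ‖u - v‖ := norm_pos_iff.2 (sub_ne_zero.2 huv)
  set d := ‖u - v‖ with hd_def
  set w := u + (r / d) • (u - v) with hw
  have hwu : w - u = (r / d) • (u - v) := by rw [hw]; abel
  have hwun : ‖w - u‖ = r := by
    rw [hwu, norm_smul, Real.norm_of_nonneg (by positivity), ← hd_def]
    field_simp
  have hu2 : u ∈ Metric.closedBall b (2 * r) :=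
    Metric.closedBall_subset_closedBall (by linarith) hu
  have hw2 : w ∈ Metric.closedBall b (2 * r) := by
    rw [Metric.mem_closedBall] at hu ⊢
    have := dist_triangle w u b
    rw [dist_eq_norm w u, hwun] at this
    linarith
  have hcomb : (r / (r + d)) • v + (d / (r + d)) • w = u := by
    rw [hw]
    match_scalars <;> field_simp <;> ring
  have hconv := hg.2 (Set.mem_univ v) (Set.mem_univ w)
    (show 0 ≤ r / (r + d) by positivity) (show 0 ≤ d / (r + d) by positivity) (by field_simp)
  rw [hcomb] at hconv
  simp only [smul_eq_mul] at hconv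
  have hconv' : r * (g u - g v) ≤ d * (g w - g u) := by
    have h := mul_le_mul_of_nonneg_left hconv (by positivity : 0 ≤ r + d)
    have e : (r + d) * (r / (r + d) * g v + d / (r + d) * g w) = r * g v + d * g w := by
      field_simp
    rw [e] at h
    linarith
  have h1 := (abs_le.1 (hfg w hw2)).2
  have h2 := (abs_le.1 (hfg u hu2)).1
  have h3 := (abs_le.1 (hf w hw2 u hu2)).2
  rw [hwun, hwu, map_smul, smul_eq_mul] at h3
  have h4 : d * (g w - g u) ≤ d * (r / d * A (u - v) + c * r + 2 * ε) :=
    mul_le_mul_of_nonneg_left (by linarith) hd.le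
  have h5 : d * (r / d * A (u - v) + c * r + 2 * ε)
      = r * (A (u - v) + (c + 2 * ε / r) * d) := by
    field_simp
    ring
  have h6 := le_of_mul_le_mul_left ((hconv'.trans h4).trans_eq h5) hr
  linarith

/-- A value taken by a map at a point where its strict derivative is onto is also taken by every
uniformly close map with convex components. -/
theorem HasStrictFDerivAt.exists_eq_of_convexOn {V ι : Type*} [NormedAddCommGroup V]
    [NormedSpace ℝ V] [CompleteSpace V] [Fintype ι] {f : V → ι → ℝ} {A : V →L[ℝ] (ι → ℝ)} {b : V}
    (hf : HasStrictFDerivAt f A b) (hA : A.range = ⊤) :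
    ∃ R > 0, ∃ ε > 0, ∀ g : V → ι → ℝ, (∀ i, ConvexOn ℝ Set.univ fun v => g v i) →
      (∀ v ∈ Metric.closedBall b R, ∀ i, |g v i - f v i| ≤ ε) → ∃ v, g v = f b := by
  set S := A.nonlinearRightInverseOfSurjective hA
  have hS : 0 < S.nnnorm := A.nonlinearRightInverseOfSurjective_nnnorm_pos hA
  set K : NNReal := S.nnnorm⁻¹ with hK
  have hKpos : (0 : ℝ) < K := by positivity
  obtain ⟨s, hs, hs'⟩ := hf.approximates_deriv_on_nhds (c := K / 4) (Or.inr (by positivity))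
  obtain ⟨R, hR, hRs⟩ := Metric.nhds_basis_closedBall.mem_iff.1 hs
  set r := R / 2 with hr_def
  have hr : 0 < r := by positivity
  have hRr : R = 2 * r := by rw [hr_def]; ring
  rw [hRr] at hRs
  refine ⟨R, hR, K * r / 8, by positivity, fun g hg hgf => ?_⟩
  rw [hRr] at hgf
  have hcomp (i : ι) : ∀ u ∈ Metric.closedBall b (2 * r), ∀ v ∈ Metric.closedBall b (2 * r),
      |f u i - f v i - ((ContinuousLinearMap.proj i).comp A : V →L[ℝ] ℝ) (u - v)|
        ≤ (K / 4 : ℝ) * ‖u - v‖ := fun u hu v hv => by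
    refine le_trans ?_ (hs' u (hRs hu) v (hRs hv))
    exact norm_le_pi_norm (f u - f v - A (u - v)) i
  have happ : ApproximatesLinearOn g A (Metric.closedBall b r) (K / 2) := by
    intro u hu v hv
    rw [pi_norm_le_iff_of_nonneg (by positivity)]
    intro i
    have h1 := (hg i).sub_sub_le_of_forall_abs_sub_le hr (hcomp i)
      (fun w hw => hgf w hw i) hu (v := v)
    have h2 := (hg i).sub_sub_le_of_forall_abs_sub_le hr (hcomp i)
      (fun w hw => hgf w hw i) hv (v := u)
    have e : (K / 4 : ℝ) + 2 * (K * r / 8) / r = K / 2 := by field_simp; ring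
    rw [e] at h1 h2
    rw [← neg_sub u v, norm_neg, map_neg] at h2
    simp only [ContinuousLinearMap.comp_apply, ContinuousLinearMap.proj_apply] at h1 h2
    simp only [Pi.sub_apply, Real.norm_eq_abs, NNReal.coe_div, NNReal.coe_ofNat]
    exact abs_le.2 ⟨by linarith, h1⟩
  have hsurj := happ.surjOn_closedBall_of_nonlinearRightInverse S hr.le subset_rfl
  have hmem : f b ∈ Metric.closedBall (g b) (((S.nnnorm : ℝ)⁻¹ - (K / 2 : NNReal)) * r) := by
    have e : ((S.nnnorm : ℝ)⁻¹ - (K / 2 : NNReal)) * r = K * r / 2 := by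
      rw [← NNReal.coe_inv, ← hK]; push_cast; ring
    rw [e, Metric.mem_closedBall, dist_comm, dist_eq_norm,
      pi_norm_le_iff_of_nonneg (by positivity)]
    intro i
    refine (hgf b (Metric.mem_closedBall_self (by positivity)) i).trans ?_
    have : 0 < K * r := by positivity
    linarith
  obtain ⟨v, -, hv⟩ := hsurj hmem
  exact ⟨v, hv⟩

theorem range_eq_top_of_rank_eq {n : ℕ} {V : Type} [AddCommGroup V] [Module ℝ V]
    {A : V →ₗ[ℝ] (PairIdx n → ℝ)}
    (hA : LinearMap.rank A = ((n * (n - 1) / 2 : ℕ) : Cardinal)) : A.range = ⊤ := by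
  apply Submodule.eq_top_of_finrank_eq
  have hcard : Fintype.card (PairIdx n) = n * (n - 1) / 2 := by
    rw [Fintype.card_subtype, Fintype.card_product_filter_lt, Fintype.card_fin,
      Nat.choose_two_right]
  rw [Module.finrank_fintype_fun_eq_card, hcard]
  exact Module.finrank_eq_of_rank_eq hA

theorem contDiff_Fmap {p : ℝ} (hp : 1 < p) (n : ℕ) : ContDiff ℝ 1 (Fmap p n) := by
  refine contDiff_pi.2 fun q => ContDiff.sum fun k _ => ?_
  simp only [← Real.norm_eq_abs]
  refine ContDiff.norm_rpow ?_ hp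
  fun_prop

theorem PiLp.norm_toLp_ofReal_rpow {p : ℝ} (hp : 0 < p) [Fact (1 ≤ ENNReal.ofReal p)] {N : ℕ}
    (v : Fin N → ℝ) :
    ‖(WithLp.toLp (ENNReal.ofReal p) v : PiLp (ENNReal.ofReal p) fun _ : Fin N => ℝ)‖ ^ p
      = ∑ k, |v k| ^ p := by
  have hpr : (ENNReal.ofReal p).toReal = p := ENNReal.toReal_ofReal hp.le
  rw [PiLp.norm_eq_sum (by rwa [hpr]), hpr, ← Real.rpow_mul (by positivity),
    one_div_mul_cancel hp.ne', Real.rpow_one]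
  simp

theorem sum_abs_extend_sub_extend_rpow {p : ℝ} {n N : ℕ} {m : Fin n → Fin N}
    (hm : Function.Injective m) (z w : Fin n → ℝ) (x y : Fin N → ℝ) :
    ∑ k, |Function.extend m z x k - Function.extend m w y k| ^ p
      = ∑ j, |z j - w j| ^ p + ∑ k ∈ (Finset.univ.image m)ᶜ, |x k - y k| ^ p := by
  rw [← Finset.sum_add_sum_compl (Finset.univ.image m), Finset.sum_image hm.injOn]
  congr 1
  · simp [hm.extend_apply]
  · refine Finset.sum_congr rfl fun k hk => ?_
    have hk' : ¬ ∃ j, m j = k := by simpa using hk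
    rw [Function.extend_apply' _ _ _ hk', Function.extend_apply' _ _ _ hk']

theorem extend_convex_combination {α β : Type*} {m : α → β} (hm : Function.Injective m)
    (z w : α → ℝ) (x : β → ℝ) {a b : ℝ} (hab : a + b = 1) :
    Function.extend m (a • z + b • w) x = a • Function.extend m z x + b • Function.extend m w x := by
  ext k
  by_cases hk : ∃ j, m j = k
  · obtain ⟨j, rfl⟩ := hk
    simp [hm.extend_apply]
  · simp only [Pi.add_apply, Pi.smul_apply, smul_eq_mul, Function.extend_apply' _ _ _ hk]
    rw [← add_mul, hab, one_mul]

theorem exists_one_add_rpow_sub_one_mul_le (p K : ℝ) {ε : ℝ} (hε : 0 < ε) :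
    ∃ δ > 0, ((1 + δ) ^ p - 1) * K ≤ ε := by
  have hcont : ContinuousAt (fun δ : ℝ => ((1 + δ) ^ p - 1) * K) 0 := by
    refine ContinuousAt.mul (ContinuousAt.sub (ContinuousAt.rpow_const ?_ ?_) ?_) ?_
    · fun_prop
    · simp
    · fun_prop
    · fun_prop
  have h0 : ((1 + (0 : ℝ)) ^ p - 1) * K < ε := by simpa using hε
  have hev := (hcont.eventually_lt_const h0).filter_mono
    (nhdsWithin_le_nhds (s := Set.Ioi (0 : ℝ)))
  obtain ⟨δ, h, hδ⟩ := (hev.and self_mem_nhdsWithin).exists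
  exact ⟨δ, hδ, h.le⟩

/-- If `x` is an `n`-tuple in `ℓ_p^N` (`N ≥ n`) with Property K, there
is `δ > 0` such that whenever `E` is an `N`-dimensional Banach space admitting a linear
isomorphism `T : ℓ_p^N → E` with `‖T‖·‖T⁻¹‖ < 1 + δ`, the metric space `{x₁,…,xₙ}`
embeds isometrically into `E`. -/
theorem stmt7 (p : ℝ) (hp : 1 < p) [Fact (1 ≤ ENNReal.ofReal p)] (n N : ℕ) (hN : n ≤ N)
    (x : Fin n → Fin N → ℝ) (hx : PropertyKFin p n N x) :
    ∃ δ > (0 : ℝ), ∀ (E : Type) [NormedAddCommGroup E] [NormedSpace ℝ E] [CompleteSpace E],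
      FiniteDimensional ℝ E → Module.finrank ℝ E = N →
      ∀ T : PiLp (ENNReal.ofReal p) (fun _ : Fin N => ℝ) ≃L[ℝ] E,
        ‖(T : PiLp (ENNReal.ofReal p) (fun _ : Fin N => ℝ) →L[ℝ] E)‖ *
          ‖(T.symm : E →L[ℝ] PiLp (ENNReal.ofReal p) (fun _ : Fin N => ℝ))‖ < 1 + δ →
        ∃ f : Fin n → E, ∀ i j, dist (f i) (f j) = pNorm p (x i - x j) := by
  have hp0 : 0 < p := by linarith
  obtain ⟨m, hmono, hG⟩ := hx
  have hm := hmono.injective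
  set z₀ : Fin n → Fin n → ℝ := fun i j => x i (m j) with hz₀
  set X : (Fin n → Fin n → ℝ) → Fin n → Fin N → ℝ :=
    fun z i => Function.extend m (z i) (x i) with hX
  set f : (Fin n → Fin n → ℝ) → PairIdx n → ℝ :=
    fun z q => ∑ k, |X z q.1.1 k - X z q.1.2 k| ^ p with hf
  have hXz₀ : X z₀ = x := by
    ext i k
    by_cases hk : ∃ j, m j = k
    · obtain ⟨j, rfl⟩ := hk
      simp [hX, hm.extend_apply, hz₀]
    · simp [hX, Function.extend_apply' _ _ _ hk]
  have hfF : f = fun z => Fmap p n z +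
      fun q : PairIdx n => ∑ k ∈ (Finset.univ.image m)ᶜ, |x q.1.1 k - x q.1.2 k| ^ p := by
    ext z q
    exact sum_abs_extend_sub_extend_rpow hm _ _ _ _
  have hder : HasStrictFDerivAt f (fderiv ℝ (Fmap p n) z₀) z₀ := by
    rw [hfF]
    exact ((contDiff_Fmap hp n).contDiffAt.hasStrictFDerivAt one_ne_zero).add_const _
  have hfcont : Continuous f := by
    rw [hfF]
    exact (contDiff_Fmap hp n).continuous.add continuous_const
  obtain ⟨R, hR, ε, hε, hsolve⟩ := hder.exists_eq_of_convexOn (range_eq_top_of_rank_eq hG)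
  obtain ⟨K, hK⟩ := (isCompact_closedBall z₀ R).exists_bound_of_continuousOn hfcont.continuousOn
  obtain ⟨δ, hδ, hδK⟩ := exists_one_add_rpow_sub_one_mul_le p K hε
  refine ⟨δ, hδ, ?_⟩
  intro E _ _ _ _ _ T hT
  set c := ‖(T.symm : E →L[ℝ] PiLp (ENNReal.ofReal p) (fun _ : Fin N => ℝ))‖ with hc
  have hc0 : 0 ≤ c := norm_nonneg _
  have hlow (y : PiLp (ENNReal.ofReal p) fun _ : Fin N => ℝ) : ‖y‖ ≤ c * ‖T y‖ := by
    simpa using (T.symm : E →L[ℝ] PiLp (ENNReal.ofReal p) (fun _ : Fin N => ℝ)).le_opNorm (T y)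
  have hupp (y : PiLp (ENNReal.ofReal p) fun _ : Fin N => ℝ) : c * ‖T y‖ ≤ (1 + δ) * ‖y‖ := by
    have h := (T : PiLp (ENNReal.ofReal p) (fun _ : Fin N => ℝ) →L[ℝ] E).le_opNorm y
    refine (mul_le_mul_of_nonneg_left h hc0).trans ?_
    rw [← mul_assoc, mul_comm c]
    exact mul_le_mul_of_nonneg_right hT.le (norm_nonneg _)
  set Y : (Fin n → Fin n → ℝ) → Fin n → E :=
    fun z i => c • T (WithLp.toLp _ (X z i)) with hY
  have hYsub (z) (i j : Fin n) :
      ‖Y z i - Y z j‖ = c * ‖T (WithLp.toLp _ (X z i - X z j))‖ := by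
    rw [hY]
    simp only
    rw [← smul_sub, ← map_sub, ← WithLp.toLp_sub, norm_smul, Real.norm_of_nonneg hc0]
  have hYaff (z w : Fin n → Fin n → ℝ) (i : Fin n) {a b : ℝ} (hab : a + b = 1) :
      Y (a • z + b • w) i = a • Y z i + b • Y w i := by
    have h : X (a • z + b • w) i = a • X z i + b • X w i :=
      extend_convex_combination hm _ _ _ hab
    simp only [hY, h, WithLp.toLp_add, WithLp.toLp_smul, map_add, map_smul, smul_add,
      smul_comm c]
  obtain ⟨z, hz⟩ := hsolve (fun z q => ‖Y z q.1.1 - Y z q.1.2‖ ^ p) (fun q => by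
      refine ⟨convex_univ, fun z _ w _ a b ha hb hab => ?_⟩
      have h : Y (a • z + b • w) q.1.1 - Y (a • z + b • w) q.1.2
          = a • (Y z q.1.1 - Y z q.1.2) + b • (Y w q.1.1 - Y w q.1.2) := by
        rw [hYaff _ _ _ hab, hYaff _ _ _ hab]
        module
      simp only [h]
      refine le_trans (Real.rpow_le_rpow (norm_nonneg _)
        ((convexOn_norm convex_univ).2 (Set.mem_univ _) (Set.mem_univ _) ha hb hab) hp0.le) ?_
      exact (convexOn_rpow hp.le).2 (norm_nonneg _) (norm_nonneg _) ha hb hab)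
    (fun z hz q => by
      have hfq : f z q = ‖(WithLp.toLp (ENNReal.ofReal p) (X z q.1.1 - X z q.1.2) :
          PiLp (ENNReal.ofReal p) fun _ : Fin N => ℝ)‖ ^ p := by
        rw [PiLp.norm_toLp_ofReal_rpow hp0]
        rfl
      have hfK : f z q ≤ K :=
        (le_abs_self _).trans ((norm_le_pi_norm (f z) q).trans (hK z hz))
      have h1 := Real.rpow_le_rpow (norm_nonneg _)
        (hlow (WithLp.toLp _ (X z q.1.1 - X z q.1.2))) hp0.le
      have h2 := Real.rpow_le_rpow (by positivity)
        (hupp (WithLp.toLp _ (X z q.1.1 - X z q.1.2))) hp0.le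
      rw [← hYsub, Real.mul_rpow (by positivity) (norm_nonneg _), ← hfq] at h2
      rw [← hYsub, ← hfq] at h1
      have hδ1 : 1 ≤ (1 + δ) ^ p := Real.one_le_rpow (by linarith) hp0.le
      have h3 : ((1 + δ) ^ p - 1) * f z q ≤ ((1 + δ) ^ p - 1) * K :=
        mul_le_mul_of_nonneg_left hfK (by linarith)
      rw [abs_of_nonneg (by linarith)]
      linarith)
  have hlt {i j : Fin n} (hij : i < j) : dist (Y z i) (Y z j) = pNorm p (x i - x j) := by
    have h := congrFun hz ⟨(i, j), hij⟩
    simp only [hf, hXz₀] at h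
    rw [pNorm, dist_eq_norm]
    simp only [Pi.sub_apply]
    rw [← h, one_div, Real.rpow_rpow_inv (norm_nonneg _) hp0.ne']
  refine ⟨Y z, fun i j => ?_⟩
  rcases lt_trichotomy i j with hij | rfl | hij
  · exact hlt hij
  · simp [pNorm, Real.zero_rpow hp0.ne', Real.zero_rpow (inv_ne_zero hp0.ne')]
  · rw [dist_comm, hlt hij]
    simp [pNorm, abs_sub_comm]
end
end

section
/- Every finite affinely independent subset of ℓ_2 embeds isometrically into every infinite-dimensional Banach space X. -/
open MeasureTheory
open scoped ENNReal
noncomputable section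

-- test lp coercion and instances

section
open ProbabilityTheory

section
variable {E X : Type*} [NormedAddCommGroup E] [InnerProductSpace ℝ E]
  [NormedAddCommGroup X] [NormedSpace ℝ X]

/-- The norm of `T` at the first component of the point rotated by `θ`. -/
def rotNorm (T : E →L[ℝ] X) (θ : ℝ) (p : E × E) : ℝ := ‖T (Real.cos θ • p.1 + Real.sin θ • p.2)‖

@[fun_prop]
theorem continuous_rotNorm (T : E →L[ℝ] X) (θ : ℝ) : Continuous (rotNorm T θ) := by
  unfold rotNorm; fun_prop

theorem rotNorm_nonneg (T : E →L[ℝ] X) (θ : ℝ) (p : E × E) : 0 ≤ rotNorm T θ p := norm_nonneg _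

theorem rotNorm_le (T : E →L[ℝ] X) (hT : ‖T‖ ≤ 1) (θ : ℝ) (p : E × E) :
    rotNorm T θ p ≤ ‖p.1‖ + ‖p.2‖ := by
  refine (T.le_of_opNorm_le hT _).trans ?_
  rw [one_mul]
  refine (norm_add_le _ _).trans ?_
  rw [norm_smul, norm_smul]
  gcongr
  · exact mul_le_of_le_one_left (norm_nonneg _) (Real.abs_cos_le_one θ)
  · exact mul_le_of_le_one_left (norm_nonneg _) (Real.abs_sin_le_one θ)

theorem rotNorm_rotation (T : E →L[ℝ] X) (θ α : ℝ) (p : E × E) :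
    rotNorm T θ (ContinuousLinearMap.rotation α p) = rotNorm T (θ + α) p := by
  simp only [rotNorm, ContinuousLinearMap.rotation_apply, Real.cos_add, Real.sin_add]
  congr 2
  module

end

section
variable {E X : Type*} [NormedAddCommGroup E] [InnerProductSpace ℝ E] [FiniteDimensional ℝ E]
  [MeasurableSpace E] [BorelSpace E] [NormedAddCommGroup X] [NormedSpace ℝ X]

theorem integrable_norm_sq_stdGaussian : Integrable (fun z : E => ‖z‖ ^ 2) (stdGaussian E) :=
  IsGaussian.memLp_two_id.integrable_norm_pow two_ne_zero

theorem integrable_prod_stdGaussian_of_norm_le {f : E × E → ℝ} (hf : Continuous f) (C : ℝ)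
    (h : ∀ p, ‖f p‖ ≤ C * (‖p.1‖ ^ 2 + ‖p.2‖ ^ 2)) :
    Integrable f ((stdGaussian E).prod (stdGaussian E)) := by
  refine Integrable.mono' (((integrable_norm_sq_stdGaussian.comp_fst _).add
    (integrable_norm_sq_stdGaussian.comp_snd _)).const_mul C) hf.aestronglyMeasurable
    (.of_forall fun p => h p)

theorem integral_rotation_stdGaussian {f : E × E → ℝ} (hf : Continuous f) (θ : ℝ) :
    ∫ p, f (ContinuousLinearMap.rotation θ p) ∂((stdGaussian E).prod (stdGaussian E))
      = ∫ p, f p ∂((stdGaussian E).prod (stdGaussian E)) := by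
  conv_rhs => rw [← IsGaussian.map_rotation_eq_self (μ := stdGaussian E) integral_id_stdGaussian θ]
  rw [integral_map (by fun_prop) hf.aestronglyMeasurable]

theorem integrable_max_rotNorm_sub (T : E →L[ℝ] X) (hT : ‖T‖ ≤ 1) (θ φ : ℝ) :
    Integrable (fun p => (max (rotNorm T θ p - rotNorm T φ p) 0) ^ 2)
      ((stdGaussian E).prod (stdGaussian E)) := by
  refine integrable_prod_stdGaussian_of_norm_le (by fun_prop) 2 fun p => ?_
  have h1 := rotNorm_le T hT θ p
  have h3 := rotNorm_nonneg T φ p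
  rw [Real.norm_of_nonneg (by positivity)]
  have h5 : max (rotNorm T θ p - rotNorm T φ p) 0 ≤ ‖p.1‖ + ‖p.2‖ :=
    max_le (by linarith) (by positivity)
  nlinarith [le_max_right (rotNorm T θ p - rotNorm T φ p) 0, sq_nonneg (‖p.1‖ - ‖p.2‖)]

theorem integral_max_rotNorm_sub_le (T : E →L[ℝ] X) (hT : ‖T‖ ≤ 1) (δ : ℝ) :
    ∫ p, (max (rotNorm T 0 p - rotNorm T δ p) 0) ^ 2 ∂((stdGaussian E).prod (stdGaussian E))
      ≤ 2 * ((1 - Real.cos δ) ^ 2 * ∫ z, ‖z‖ ^ 2 ∂(stdGaussian E) + Real.sin δ ^ 2) := by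
  rw [integral_prod _ (integrable_max_rotNorm_sub T hT 0 δ)]
  have h : ∀ z : E, ∫ y, (max (rotNorm T 0 (z, y) - rotNorm T δ (z, y)) 0) ^ 2 ∂(stdGaussian E)
      ≤ 2 * ((1 - Real.cos δ) ^ 2 * ‖z‖ ^ 2 + Real.sin δ ^ 2) := by
    intro z
    obtain ⟨φ, hφ, hφz⟩ := exists_dual_vector'' ℝ (T z)
    let l : StrongDual ℝ E := φ.comp T
    have hl : ‖l‖ ≤ 1 := (φ.opNorm_comp_le T).trans (mul_le_one₀ hφ (norm_nonneg _) hT)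
    have hlz : l z ≤ ‖z‖ := by
      simpa using (le_abs_self _).trans (l.le_of_opNorm_le hl z)
    have hlz0 : 0 ≤ l z := by simp [l, hφz]
    have hl2 : ∫ y, l y ^ 2 ∂(stdGaussian E) ≤ 1 := by
      have h1 := variance_dual_stdGaussian l
      rw [variance_of_integral_eq_zero (by fun_prop) (integral_strongDual_stdGaussian l)] at h1
      rw [h1]
      exact pow_le_one₀ (norm_nonneg _) hl
    have hli : Integrable (fun y => l y ^ 2) (stdGaussian E) := by
      refine integrable_norm_sq_stdGaussian.mono' (by fun_prop) (.of_forall fun y => ?_)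
      rw [norm_pow]
      gcongr
      simpa using l.le_of_opNorm_le hl y
    calc _ ≤ ∫ y, (2 * (1 - Real.cos δ) ^ 2 * ‖z‖ ^ 2 + 2 * Real.sin δ ^ 2 * l y ^ 2)
            ∂(stdGaussian E) := by
          refine integral_mono_of_nonneg (.of_forall fun y => by positivity)
            ((integrable_const _).add (hli.const_mul _)) (.of_forall fun y => ?_)
          have h2 : l (Real.cos δ • z + Real.sin δ • y) ≤ rotNorm T δ (z, y) := by
            simpa [l, rotNorm] using
              (le_abs_self _).trans (φ.le_of_opNorm_le hφ (T (Real.cos δ • z + Real.sin δ • y)))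
          have h3 : rotNorm T 0 (z, y) = l z := by simp [rotNorm, l, hφz]
          simp only [map_add, map_smul, smul_eq_mul] at h2
          have h4 : max (rotNorm T 0 (z, y) - rotNorm T δ (z, y)) 0
              ≤ |(1 - Real.cos δ) * l z - Real.sin δ * l y| := by
            refine max_le (le_trans ?_ (le_abs_self _)) (abs_nonneg _)
            rw [h3]; linarith
          have h5 := pow_le_pow_left₀ (le_max_right _ _) h4 2
          rw [sq_abs] at h5
          have h6 : ((1 - Real.cos δ) * l z) ^ 2 ≤ (1 - Real.cos δ) ^ 2 * ‖z‖ ^ 2 := by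
            rw [mul_pow]; gcongr
          dsimp only
          nlinarith [sq_nonneg ((1 - Real.cos δ) * l z + Real.sin δ * l y)]
      _ = 2 * (1 - Real.cos δ) ^ 2 * ‖z‖ ^ 2 +
            2 * Real.sin δ ^ 2 * ∫ y, l y ^ 2 ∂(stdGaussian E) := by
          rw [integral_add (integrable_const _) (hli.const_mul _),
            integral_const_mul (2 * Real.sin δ ^ 2)]
          simp
      _ ≤ _ := by nlinarith [sq_nonneg (Real.sin δ)]
  calc _ ≤ ∫ z : E, 2 * ((1 - Real.cos δ) ^ 2 * ‖z‖ ^ 2 + Real.sin δ ^ 2) ∂(stdGaussian E) := by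
        refine integral_mono_of_nonneg (.of_forall fun z => integral_nonneg fun y => by positivity)
          (((integrable_norm_sq_stdGaussian.const_mul _).add (integrable_const _)).const_mul _)
          (.of_forall h)
    _ = _ := by
        rw [integral_const_mul, integral_add (integrable_norm_sq_stdGaussian.const_mul _)
          (integrable_const _), integral_const_mul]
        simp

theorem integrable_rotNorm_sub_sq (T : E →L[ℝ] X) (hT : ‖T‖ ≤ 1) (θ φ : ℝ) :
    Integrable (fun p => (rotNorm T θ p - rotNorm T φ p) ^ 2)
      ((stdGaussian E).prod (stdGaussian E)) := by
  refine ((integrable_max_rotNorm_sub T hT θ φ).add (integrable_max_rotNorm_sub T hT φ θ)).congr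
    (.of_forall fun p => ?_)
  dsimp only [Pi.add_apply]
  rcases le_total (rotNorm T θ p) (rotNorm T φ p) with h | h
  · rw [max_eq_right (by linarith), max_eq_left (by linarith)]; ring
  · rw [max_eq_left (by linarith), max_eq_right (by linarith)]; ring

theorem integral_rotNorm_sub_sq_le (T : E →L[ℝ] X) (hT : ‖T‖ ≤ 1) (θ δ : ℝ) :
    ∫ p, (rotNorm T θ p - rotNorm T (θ + δ) p) ^ 2 ∂((stdGaussian E).prod (stdGaussian E))
      ≤ 4 * ((1 - Real.cos δ) ^ 2 * ∫ z, ‖z‖ ^ 2 ∂(stdGaussian E) + Real.sin δ ^ 2) := by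
  have h1 : ∀ p, (rotNorm T θ p - rotNorm T (θ + δ) p) ^ 2 =
      (max (rotNorm T 0 (ContinuousLinearMap.rotation θ p)
        - rotNorm T δ (ContinuousLinearMap.rotation θ p)) 0) ^ 2 +
      (max (rotNorm T 0 (ContinuousLinearMap.rotation (θ + δ) p)
        - rotNorm T (-δ) (ContinuousLinearMap.rotation (θ + δ) p)) 0) ^ 2 := by
    intro p
    simp only [rotNorm_rotation, zero_add, neg_add_cancel_comm_assoc, add_comm δ θ]
    rcases le_total (rotNorm T θ p) (rotNorm T (θ + δ) p) with h | h
    · rw [max_eq_right (by linarith), max_eq_left (by linarith)]; ring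
    · rw [max_eq_left (by linarith), max_eq_right (by linarith)]; ring
  have h2 : ∀ η α, Integrable (fun p => (max (rotNorm T 0 (ContinuousLinearMap.rotation α p)
        - rotNorm T η (ContinuousLinearMap.rotation α p)) 0) ^ 2)
        ((stdGaussian E).prod (stdGaussian E)) := by
    intro η α
    simp only [rotNorm_rotation]
    exact integrable_max_rotNorm_sub T hT _ _
  simp_rw [h1]
  rw [integral_add (h2 _ _) (h2 _ _),
    integral_rotation_stdGaussian (f := fun p => (max (rotNorm T 0 p - rotNorm T δ p) 0) ^ 2)
      (by fun_prop),
    integral_rotation_stdGaussian (f := fun p => (max (rotNorm T 0 p - rotNorm T (-δ) p) 0) ^ 2)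
      (by fun_prop)]
  have h3 := integral_max_rotNorm_sub_le T hT δ
  have h4 := integral_max_rotNorm_sub_le T hT (-δ)
  rw [Real.cos_neg, Real.sin_neg, neg_sq] at h4
  linarith

theorem integral_prod_norm_sub_sq_le (T : E →L[ℝ] X) (hT : ‖T‖ ≤ 1) :
    ∫ p, (‖T p.1‖ - ‖T p.2‖) ^ 2 ∂((stdGaussian E).prod (stdGaussian E)) ≤ 32 := by
  set K : ℝ := ∫ z, ‖z‖ ^ 2 ∂(stdGaussian E)
  have hK : 0 ≤ K := integral_nonneg fun z => by positivity
  obtain ⟨N, hN⟩ := exists_nat_gt K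
  have hN0 : (0 : ℝ) < N := hK.trans_lt hN
  have hN1 : (1 : ℝ) ≤ N := by exact_mod_cast Nat.cast_pos.1 hN0
  set δ : ℝ := Real.pi / 2 / N
  have hδ0 : 0 ≤ δ := by positivity
  have hδN : N * δ = Real.pi / 2 := by simp only [δ]; field_simp
  have hδN2 : N * δ ≤ 2 := by rw [hδN]; linarith [Real.pi_le_four]
  have h1 : ∀ p : E × E, (‖T p.1‖ - ‖T p.2‖) ^ 2 ≤
      N * ∑ l ∈ Finset.range N, (rotNorm T (l * δ) p - rotNorm T (l * δ + δ) p) ^ 2 := by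
    intro p
    have h2 : ∑ l ∈ Finset.range N, (rotNorm T (l * δ) p - rotNorm T (l * δ + δ) p)
        = ‖T p.1‖ - ‖T p.2‖ := by
      have := Finset.sum_range_sub' (fun l : ℕ => rotNorm T (l * δ) p) N
      simp only [Nat.cast_add, Nat.cast_one, add_mul, one_mul, Nat.cast_zero, zero_mul, hδN] at this
      rw [this]
      simp [rotNorm]
    rw [← h2]
    simpa using sq_sum_le_card_mul_sum_sq (s := Finset.range N)
      (f := fun l => rotNorm T (l * δ) p - rotNorm T (l * δ + δ) p)
  have hint := fun l : ℕ => integrable_rotNorm_sub_sq T hT (l * δ) (l * δ + δ)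
  calc _ ≤ ∫ p, N * ∑ l ∈ Finset.range N, (rotNorm T (l * δ) p - rotNorm T (l * δ + δ) p) ^ 2
          ∂((stdGaussian E).prod (stdGaussian E)) :=
        integral_mono_of_nonneg (.of_forall fun p => by positivity)
          ((integrable_finsetSum _ fun l _ => hint l).const_mul _) (.of_forall h1)
    _ = N * ∑ l ∈ Finset.range N, ∫ p, (rotNorm T (l * δ) p - rotNorm T (l * δ + δ) p) ^ 2
          ∂((stdGaussian E).prod (stdGaussian E)) := by
        rw [integral_const_mul, integral_finsetSum _ fun l _ => hint l]
    _ ≤ N * ∑ l ∈ Finset.range N, 4 * ((1 - Real.cos δ) ^ 2 * K + Real.sin δ ^ 2) := by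
        gcongr with l
        exact integral_rotNorm_sub_sq_le T hT _ _
    _ = 4 * N ^ 2 * ((1 - Real.cos δ) ^ 2 * K + Real.sin δ ^ 2) := by
        rw [Finset.sum_const, Finset.card_range, nsmul_eq_mul]; ring
    _ ≤ 4 * N ^ 2 * ((δ ^ 2 / 2) ^ 2 * N + δ ^ 2) := by
        have h3 := Real.one_sub_sq_div_two_le_cos (x := δ)
        have h4 := Real.sin_sq_le_sq (x := δ)
        have h5 := Real.cos_le_one δ
        gcongr; linarith
    _ = 4 * (N * δ) ^ 2 + (N * δ) ^ 4 / N := by field_simp; ring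
    _ ≤ 4 * 2 ^ 2 + 2 ^ 4 / 1 := by gcongr
    _ = 32 := by norm_num

theorem integral_norm_sub_integral_sq_le (T : E →L[ℝ] X) (hT : ‖T‖ ≤ 1) :
    ∫ z, (‖T z‖ - ∫ y, ‖T y‖ ∂(stdGaussian E)) ^ 2 ∂(stdGaussian E) ≤ 16 := by
  have h := integral_prod_norm_sub_sq_le T hT
  set M := ∫ y, ‖T y‖ ∂(stdGaussian E)
  have hi2 : Integrable (fun z => ‖T z‖ ^ 2) (stdGaussian E) := by
    refine integrable_norm_sq_stdGaussian.mono' (by fun_prop) (.of_forall fun y => ?_)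
    rw [norm_pow, norm_norm]
    gcongr
    simpa using T.le_of_opNorm_le hT y
  have hi : Integrable (fun z => ‖T z‖) (stdGaussian E) :=
    (T.integrable_comp IsGaussian.integrable_id).norm
  have h1 : ∫ p, (‖T p.1‖ - ‖T p.2‖) ^ 2 ∂((stdGaussian E).prod (stdGaussian E)) =
      2 * (∫ z, ‖T z‖ ^ 2 ∂(stdGaussian E)) - 2 * M ^ 2 := by
    have h2 : ∀ p : E × E, (‖T p.1‖ - ‖T p.2‖) ^ 2 =
        ‖T p.1‖ ^ 2 + ‖T p.2‖ ^ 2 - 2 * (‖T p.1‖ * ‖T p.2‖) := fun p => by ring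
    simp_rw [h2]
    have h4 : Integrable (fun p : E × E => ‖T p.1‖ ^ 2 + ‖T p.2‖ ^ 2)
        ((stdGaussian E).prod (stdGaussian E)) := (hi2.comp_fst _).add (hi2.comp_snd _)
    rw [integral_sub h4 ((hi.mul_prod hi).const_mul _),
      integral_add (hi2.comp_fst _) (hi2.comp_snd _), integral_const_mul,
      integral_prod_mul (fun z => ‖T z‖) (fun z => ‖T z‖),
      integral_fun_fst (fun z => ‖T z‖ ^ 2), integral_fun_snd (fun z => ‖T z‖ ^ 2)]
    simp [M]; ring
  have h3 : ∫ z, (‖T z‖ - M) ^ 2 ∂(stdGaussian E) = (∫ z, ‖T z‖ ^ 2 ∂(stdGaussian E)) - M ^ 2 := by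
    have h2 : ∀ z : E, (‖T z‖ - M) ^ 2 = ‖T z‖ ^ 2 - 2 * M * ‖T z‖ + M ^ 2 := fun z => by ring
    simp_rw [h2]
    have h4 : Integrable (fun z => ‖T z‖ ^ 2 - 2 * M * ‖T z‖) (stdGaussian E) :=
      hi2.sub (hi.const_mul _)
    rw [integral_add h4 (integrable_const _),
      integral_sub hi2 (hi.const_mul _), integral_const_mul]
    simp [M]; ring
  linarith

end

theorem reflection_single_apply {d : ℕ} (i j : Fin d) (z : EuclideanSpace ℝ (Fin d)) :
    (ℝ ∙ EuclideanSpace.single i (1 : ℝ)).reflection z j = if j = i then z j else - z j := by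
  rw [Submodule.reflection_apply, Submodule.starProjection_unit_singleton _ (by simp)]
  simp only [EuclideanSpace.inner_single_left]
  split_ifs with h
  · subst h; simp; ring
  · simp [h]

theorem le_setIntegral_norm_stdGaussian {X : Type*} [NormedAddCommGroup X] [NormedSpace ℝ X] {d : ℕ}
    (T : EuclideanSpace ℝ (Fin d) →L[ℝ] X) (i : Fin d)
    (hT : 1 / 4 ≤ ‖T (EuclideanSpace.single i 1)‖) {t : ℝ} (ht : 0 ≤ t)
    {A : Set (EuclideanSpace ℝ (Fin d))} (hA : MeasurableSet A) (hAt : ∀ z ∈ A, t ≤ |z i|)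
    (hAr : (ℝ ∙ EuclideanSpace.single i (1 : ℝ)).reflection ⁻¹' A = A) :
    t / 4 * (stdGaussian (EuclideanSpace ℝ (Fin d))).real A
      ≤ ∫ z in A, ‖T z‖ ∂(stdGaussian (EuclideanSpace ℝ (Fin d))) := by
  set γ := stdGaussian (EuclideanSpace ℝ (Fin d))
  set ρ := (ℝ ∙ EuclideanSpace.single i (1 : ℝ)).reflection
  have hρ : MeasurePreserving ρ γ γ := ⟨by fun_prop, stdGaussian_map ρ⟩
  have hi : Integrable (fun z => ‖T z‖) γ := (T.integrable_comp IsGaussian.integrable_id).norm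
  have h1 : ∫ z in A, ‖T (ρ z)‖ ∂γ = ∫ z in A, ‖T z‖ ∂γ := by
    have := hρ.setIntegral_preimage_emb ρ.toHomeomorph.measurableEmbedding (fun z => ‖T z‖) A
    rwa [hAr] at this
  have hi' : Integrable (fun z => ‖T (ρ z)‖) γ := hρ.integrable_comp_of_integrable hi
  have h2 : ∫ z in A, t / 2 ∂γ ≤ ∫ z in A, (‖T z‖ + ‖T (ρ z)‖) ∂γ := by
    refine setIntegral_mono_on (integrable_const _) ?_ hA fun z hz => ?_
    · exact (hi.add hi').integrableOn
    · refine le_trans ?_ (norm_add_le _ _)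
      have : z + ρ z = (2 * z i) • EuclideanSpace.single i (1 : ℝ) := by
        ext j
        simp only [PiLp.add_apply, ρ, reflection_single_apply, PiLp.smul_apply]
        split_ifs with h
        · subst h; simp; ring
        · simp [h]
      rw [← map_add, this, map_smul, norm_smul, norm_mul, Real.norm_two, Real.norm_eq_abs]
      nlinarith [hAt z hz]
  rw [integral_add hi.integrableOn hi'.integrableOn, h1,
    setIntegral_const, smul_eq_mul] at h2
  linarith

theorem stdGaussian_real_forall_abs_lt (d : ℕ) (t : ℝ) :
    (stdGaussian (EuclideanSpace ℝ (Fin d))).real {z | ∀ i, |z i| < t}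
      = (gaussianReal 0 1).real {x | |x| < t} ^ d := by
  have hm : MeasurableSet {z : EuclideanSpace ℝ (Fin d) | ∀ i, |z i| < t} := by
    simp only [Set.ofPred_forall]
    exact MeasurableSet.iInter fun i => measurableSet_lt (by fun_prop) (by fun_prop)
  rw [measureReal_def, ← map_pi_eq_stdGaussian, Measure.map_apply (by fun_prop) hm]
  have : (WithLp.toLp 2 ⁻¹' {z : EuclideanSpace ℝ (Fin d) | ∀ i, |z i| < t})
      = Set.univ.pi fun _ => {x : ℝ | |x| < t} := by
    ext; simp
  rw [this, Measure.pi_pi]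
  simp [measureReal_def]

theorem gaussianReal_abs_lt_lt_one {t : ℝ} :
    (gaussianReal 0 1).real {x : ℝ | |x| < t} < 1 := by
  have h0 : MeasurableSet {x : ℝ | |x| < t} := measurableSet_lt (by fun_prop) (by fun_prop)
  have h1 := probReal_compl_eq_one_sub (μ := gaussianReal 0 1) h0
  have h2 : 0 < (gaussianReal 0 1).real {x : ℝ | |x| < t}ᶜ := by
    rw [measureReal_def, ENNReal.toReal_pos_iff]
    refine ⟨pos_iff_ne_zero.2 fun h => ?_, measure_lt_top _ _⟩
    have h3 : (volume : Measure ℝ) (Set.Ici t) = 0 := measure_mono_null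
      (fun x (hx : t ≤ x) => not_lt.2 (hx.trans (le_abs_self x)))
      (gaussianReal_absolutelyContinuous' 0 one_ne_zero h)
    simp at h3
  linarith

theorem exists_forall_le_integral_norm_stdGaussian (K : ℝ) : ∃ d : ℕ, ∀ {X : Type*}
    [NormedAddCommGroup X] [NormedSpace ℝ X] (T : EuclideanSpace ℝ (Fin d) →L[ℝ] X),
    (∀ i, 1 / 4 ≤ ‖T (EuclideanSpace.single i 1)‖) →
      K ≤ ∫ z, ‖T z‖ ∂(stdGaussian (EuclideanSpace ℝ (Fin d))) := by
  let t := 8 * |K|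
  obtain ⟨d, hd⟩ := exists_pow_lt_of_lt_one (one_half_pos (α := ℝ))
    (gaussianReal_abs_lt_lt_one (t := t))
  refine ⟨d, fun {X} _ _ T hT => ?_⟩
  have ht : 0 ≤ t := by positivity
  set γ := stdGaussian (EuclideanSpace ℝ (Fin d))
  let A : Fin d → Set (EuclideanSpace ℝ (Fin d)) := fun i => {z | t ≤ |z i| ∧ ∀ j < i, |z j| < t}
  have hA : ∀ i, MeasurableSet (A i) := fun i => by
    simp only [A, Set.ofPred_and, Set.ofPred_forall]
    refine (measurableSet_le (by fun_prop) (by fun_prop)).inter ?_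
    exact MeasurableSet.iInter fun j => MeasurableSet.iInter fun _ =>
      measurableSet_lt (by fun_prop) (by fun_prop)
  have hdisj : Pairwise (Function.onFun Disjoint A) := by
    refine (pairwise_disjoint_on A).2 fun i j hij => ?_
    rw [Set.disjoint_left]
    exact fun z hz hz' => (hz'.2 i hij).not_ge hz.1
  have hunion : ⋃ i, A i = {z | ∀ i, |z i| < t}ᶜ := by
    ext z
    simp only [A, Set.mem_iUnion, Set.mem_compl_iff, Set.mem_ofPred_eq, not_forall, not_lt]
    refine ⟨fun ⟨i, hi⟩ => ⟨i, hi.1⟩, fun h => ?_⟩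
    obtain ⟨i, hi, hmin⟩ := exists_minimal_of_wellFoundedLT (fun i => t ≤ |z i|) h
    exact ⟨i, hi, fun j hj => by
      by_contra! hc
      exact absurd (hmin hc hj.le) hj.not_ge⟩
  have hi : Integrable (fun z => ‖T z‖) γ := (T.integrable_comp IsGaussian.integrable_id).norm
  have h1 : 1 / 2 ≤ γ.real (⋃ i, A i) := by
    have hm := (MeasurableSet.iUnion hA).compl
    rw [hunion, compl_compl] at hm
    rw [hunion, probReal_compl_eq_one_sub hm, stdGaussian_real_forall_abs_lt]
    linarith
  calc K ≤ t / 4 * (1 / 2) := by simp only [t]; linarith [le_abs_self K]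
    _ ≤ t / 4 * γ.real (⋃ i, A i) := by gcongr
    _ = ∑ i, t / 4 * γ.real (A i) := by
      rw [measureReal_iUnion_fintype hdisj hA, Finset.mul_sum]
    _ ≤ ∑ i, ∫ z in A i, ‖T z‖ ∂γ := by
      refine Finset.sum_le_sum fun i _ =>
        le_setIntegral_norm_stdGaussian T i (hT i) ht (hA i) (fun z hz => hz.1) ?_
      ext z
      simp only [A, Set.mem_preimage, Set.mem_ofPred_eq, reflection_single_apply]
      refine and_congr (by simp) (forall₂_congr fun j hj => ?_)
      simp [hj.ne]
    _ = ∫ z in ⋃ i, A i, ‖T z‖ ∂γ :=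
      (integral_iUnion_fintype hA hdisj fun i => hi.integrableOn).symm
    _ ≤ ∫ z, ‖T z‖ ∂γ := setIntegral_le_integral hi (.of_forall fun z => norm_nonneg _)

theorem det_id_add_starProjection {E : Type*} [NormedAddCommGroup E] [InnerProductSpace ℝ E]
    [FiniteDimensional ℝ E] (U : Submodule ℝ E) :
    (ContinuousLinearMap.id ℝ E + U.starProjection).det = 2 ^ Module.finrank ℝ U := by
  have hP : LinearMap.IsProj U (U.starProjection : E →ₗ[ℝ] E) :=
    ⟨fun x => U.starProjection_apply_mem x, fun x hx => U.starProjection_eq_self_iff.2 hx⟩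
  have h := hP.eq_conj_prodMap
  have h2 : ((ContinuousLinearMap.id ℝ E + U.starProjection : E →L[ℝ] E) : E →ₗ[ℝ] E)
      = (U.prodEquivOfIsCompl _ hP.isCompl).conj
        (LinearMap.prodMap ((2 : ℝ) • LinearMap.id) LinearMap.id) := by
    have h3 : LinearMap.prodMap ((2 : ℝ) • LinearMap.id (R := ℝ) (M := U))
        (LinearMap.id (R := ℝ) (M := LinearMap.ker (U.starProjection : E →ₗ[ℝ] E)))
        = LinearMap.id + LinearMap.prodMap (LinearMap.id (R := ℝ) (M := U)) 0 := by
      ext <;> simp [two_smul]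
    rw [h3, map_add, ← h]
    ext; simp
  rw [ContinuousLinearMap.det, h2, LinearEquiv.conj_apply, LinearMap.comp_assoc,
    LinearMap.det_conj, LinearMap.det_prodMap]
  simp

theorem exists_linearMap_norm_single_ge {X : Type*} [NormedAddCommGroup X] [NormedSpace ℝ X]
    (hX : ¬ FiniteDimensional ℝ X) (d : ℕ) :
    ∃ T : EuclideanSpace ℝ (Fin d) →L[ℝ] X, ‖T‖ ≤ 1 ∧
      ∀ i, 1 / 4 ≤ ‖T (EuclideanSpace.single i 1)‖ := by
  let E := EuclideanSpace ℝ (Fin (2 * d))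
  obtain ⟨w, hw⟩ : ∃ w : E →L[ℝ] X, Function.Injective w := by
    obtain ⟨v, hv⟩ : ∃ v : Fin (2 * d) → X, LinearIndependent ℝ v := by
      have : ((2 * d : ℕ) : Cardinal) ≤ Module.rank ℝ X :=
        (Cardinal.natCast_lt_aleph0.le).trans
          (not_lt.1 fun h => hX (Module.rank_lt_aleph0_iff.1 h))
      exact exists_linearIndependent_of_le_rank this
    refine ⟨LinearMap.toContinuousLinearMap
      ((Fintype.linearCombination ℝ v).comp
        (WithLp.linearEquiv 2 ℝ (Fin (2 * d) → ℝ)).toLinearMap), ?_⟩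
    exact (hv.fintypeLinearCombination_injective).comp (WithLp.linearEquiv 2 ℝ _).injective
  let K : Set (E →L[ℝ] E) := {A | ∀ x, ‖w (A x)‖ ≤ ‖x‖}
  have : ProperSpace (E →L[ℝ] E) := FiniteDimensional.proper ℝ _
  obtain ⟨c, hc, hcw⟩ : ∃ c : ℝ, 0 < c ∧ ∀ x, ‖x‖ ≤ c * ‖w x‖ := by
    obtain ⟨c, hc, h⟩ := LinearMap.exists_antilipschitzWith (w : E →ₗ[ℝ] X)
      (LinearMap.ker_eq_bot.2 hw)
    exact ⟨c, hc, fun x => by simpa using h.le_mul_dist x 0⟩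
  have hKc : IsCompact K := by
    refine Metric.isCompact_of_isClosed_isBounded ?_ ?_
    · simp only [K, Set.ofPred_forall]
      exact isClosed_iInter fun x => isClosed_le (by fun_prop) (by fun_prop)
    · refine isBounded_iff_forall_norm_le.2 ⟨c, fun A hA => ?_⟩
      refine A.opNorm_le_bound hc.le fun x => (hcw _).trans ?_
      gcongr
      exact hA x
  obtain ⟨δ, hδ, hδK⟩ : ∃ δ : ℝ, 0 < δ ∧ δ • ContinuousLinearMap.id ℝ E ∈ K := by
    refine ⟨(‖w‖ + 1)⁻¹, by positivity, fun x => ?_⟩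
    have := w.le_opNorm x
    simp only [smul_apply, ContinuousLinearMap.id_apply, map_smul, norm_smul]
    rw [Real.norm_of_nonneg (by positivity), inv_mul_le_iff₀ (by positivity)]
    nlinarith [norm_nonneg x]
  obtain ⟨A, hAK, hA⟩ := hKc.exists_isMaxOn ⟨_, hδK⟩
    (f := fun A : E →L[ℝ] E => |A.det|) (ContinuousLinearMap.continuous_det.abs.continuousOn)
  have hA0 : 0 < |A.det| := by
    refine lt_of_lt_of_le ?_ (hA hδK)
    rw [abs_pos, ContinuousLinearMap.det]
    simp [LinearMap.det_smul, hδ.ne']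
  have key : ∀ r ≤ d, ∃ y : Fin r → E, Orthonormal ℝ y ∧ ∀ i, 1 / 4 ≤ ‖w (A (y i))‖ := by
    intro r
    induction r with
    | zero => exact fun _ => ⟨Fin.elim0, ⟨fun i => i.elim0, fun i => i.elim0⟩, fun i => i.elim0⟩
    | succ r ih =>
      intro hr
      obtain ⟨y, hy, hyA⟩ := ih (by omega)
      let U : Submodule ℝ E := (Submodule.span ℝ (Set.range y))ᗮ
      have hU : Module.finrank ℝ U = 2 * d - r := by
        have h1 := Submodule.finrank_add_finrank_orthogonal (Submodule.span ℝ (Set.range y))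
        rw [finrank_span_eq_card hy.linearIndependent] at h1
        have h2 : Module.finrank ℝ E = 2 * d := finrank_euclideanSpace_fin
        rw [h2, Fintype.card_fin] at h1
        exact Nat.eq_sub_of_add_eq' h1
      obtain ⟨z, hzU, hz, hzA⟩ : ∃ z ∈ U, ‖z‖ = 1 ∧ 1 / 4 ≤ ‖w (A z)‖ := by
        by_contra! hcon
        have hU4 : ∀ z ∈ U, ‖w (A z)‖ ≤ 1 / 4 * ‖z‖ := by
          intro z hz
          rcases eq_or_ne z 0 with rfl | h0
          · simp
          have h0' : 0 < ‖z‖ := norm_pos_iff.2 h0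
          have := hcon (‖z‖⁻¹ • z) (U.smul_mem _ hz)
            (by rw [norm_smul, norm_inv, norm_norm, inv_mul_cancel₀ h0'.ne'])
          rw [map_smul, map_smul, norm_smul, norm_inv, norm_norm, inv_mul_lt_iff₀ h0'] at this
          linarith
        let B : E →L[ℝ] E := (4 / 5 : ℝ) • (A.comp (ContinuousLinearMap.id ℝ E + U.starProjection))
        have hB : B ∈ K := by
          intro x
          have h1 := hU4 _ (U.starProjection_apply_mem x)
          have h2 : ‖U.starProjection x‖ ≤ ‖x‖ := U.norm_starProjection_apply_le x
          have h3 := hAK x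
          have h4 := norm_add_le (w (A x)) (w (A (U.starProjection x)))
          simp only [B, smul_apply, ContinuousLinearMap.comp_apply,
            add_apply, ContinuousLinearMap.id_apply, map_smul, map_add,
            norm_smul]
          rw [Real.norm_of_nonneg (by norm_num)]
          linarith
        have hdet : |B.det| = ((4 / 5) ^ (2 * d) * 2 ^ (2 * d - r)) * |A.det| := by
          have : B.det = (4 / 5) ^ (2 * d) * (A.det * 2 ^ (2 * d - r)) := by
            rw [← hU, ← det_id_add_starProjection]
            simp only [B, ContinuousLinearMap.det, ContinuousLinearMap.toLinearMap_smul,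
              ContinuousLinearMap.toLinearMap_comp, LinearMap.det_smul, LinearMap.det_comp]
            simp [E]
          rw [this, abs_mul, abs_mul, abs_of_pos (by positivity),
            abs_of_pos (a := (2 : ℝ) ^ _) (by positivity)]
          ring
        have h5 : (1 : ℝ) < (4 / 5) ^ (2 * d) * 2 ^ (2 * d - r) := by
          have h6 : (2 : ℝ) ^ d ≤ 2 ^ (2 * d - r) := pow_le_pow_right₀ (by norm_num) (by omega)
          calc (1 : ℝ) < (32 / 25) ^ d := one_lt_pow₀ (by norm_num) (by omega)
            _ = (4 / 5) ^ (2 * d) * 2 ^ d := by rw [pow_mul, ← mul_pow]; norm_num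
            _ ≤ _ := by gcongr
        have h7 : |B.det| ≤ |A.det| := hA hB
        rw [hdet] at h7
        nlinarith
      refine ⟨Matrix.vecCons z y, orthonormal_vecCons_iff.2 ⟨hz, fun i => ?_, hy⟩, fun i => ?_⟩
      · exact Submodule.inner_left_of_mem_orthogonal
          (Submodule.subset_span (Set.mem_range_self i) : y i ∈ Submodule.span ℝ (Set.range y)) hzU
      · refine Fin.cases ?_ (fun j => ?_) i
        · simpa using hzA
        · simpa using hyA j
  obtain ⟨y, hy, hyA⟩ := key d le_rfl
  let b := EuclideanSpace.basisFun (Fin d) ℝ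
  let Y : EuclideanSpace ℝ (Fin d) →ₗᵢ[ℝ] E :=
    LinearMap.isometryOfOrthonormal (b.toBasis.constr ℝ y) (v := b.toBasis)
      (by simp) (by convert hy; ext i; simp)
  refine ⟨(w.comp A).comp Y.toContinuousLinearMap, ?_, fun i => ?_⟩
  · refine ContinuousLinearMap.opNorm_le_bound _ zero_le_one fun x => ?_
    simpa using (hAK (Y x)).trans_eq (Y.norm_map x)
  · have : Y (EuclideanSpace.single i 1) = y i := by
      have h := b.toBasis.constr_basis ℝ y i
      rwa [b.coe_toBasis, EuclideanSpace.basisFun_apply] at h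
    simpa [this] using hyA i

section
variable {E X : Type*} [NormedAddCommGroup E] [InnerProductSpace ℝ E] [FiniteDimensional ℝ E]
  [MeasurableSpace E] [BorelSpace E] [NormedAddCommGroup X] [NormedSpace ℝ X]

theorem measurable_sum_smul {k : ℕ} (x : EuclideanSpace ℝ (Fin k)) :
    Measurable fun ω : Fin k → E => ∑ j, x j • ω j :=
  Finset.measurable_sum _ fun j _ => (measurable_pi_apply j).const_smul (x j)

theorem map_sum_smul_pi_stdGaussian {k : ℕ} (x : EuclideanSpace ℝ (Fin k)) :
    (Measure.pi fun _ : Fin k => stdGaussian E).map (fun ω => ∑ j, x j • ω j)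
      = (stdGaussian E).map (fun z => ‖x‖ • z) := by
  have := Measure.isProbabilityMeasure_map (μ := stdGaussian E) (f := fun z => ‖x‖ • z)
    (by fun_prop)
  have := Measure.isProbabilityMeasure_map (μ := Measure.pi fun _ : Fin k => stdGaussian E)
    (f := fun ω => ∑ j, x j • ω j) (measurable_sum_smul x).aemeasurable
  refine Measure.ext_of_charFun (funext fun t => ?_)
  rw [charFun_map_smul, charFun_apply,
    integral_map (measurable_sum_smul x).aemeasurable (by fun_prop)]
  have h1 : ∀ ω : Fin k → E, Complex.exp (inner ℝ (∑ j, x j • ω j) t * Complex.I)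
      = ∏ j, Complex.exp (inner ℝ (ω j) (x j • t) * Complex.I) := by
    intro ω
    rw [← Complex.exp_sum, sum_inner, Complex.ofReal_sum, Finset.sum_mul]
    simp [real_inner_smul_left, real_inner_smul_right]
  simp_rw [h1]
  rw [integral_fintype_prod_eq_prod
    (f := fun j (z : E) => Complex.exp (inner ℝ z (x j • t) * Complex.I))]
  simp_rw [← charFun_apply, charFun_stdGaussian]
  rw [← Complex.exp_sum]
  congr 1
  have h2 := EuclideanSpace.real_norm_sq_eq x
  have h3 : ∀ y : E, ∀ c : ℝ, ‖c • y‖ ^ 2 = c ^ 2 * ‖y‖ ^ 2 := fun y c => by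
    rw [norm_smul, mul_pow, Real.norm_eq_abs, sq_abs]
  norm_cast
  rw [← Finset.sum_div, Finset.sum_neg_distrib]
  simp_rw [h3]
  rw [← Finset.sum_mul, h2]

theorem integrable_norm_sub_const_sq (T : E →L[ℝ] X) (M : ℝ) :
    Integrable (fun z => (‖T z‖ - M) ^ 2) (stdGaussian E) := by
  have h := IsGaussian.memLp_two_id (μ := stdGaussian E)
  have h2 : MemLp (fun z => ‖T z‖ - M) 2 (stdGaussian E) :=
    (T.comp_memLp' h).norm.sub (memLp_const M)
  exact h2.integrable_sq

theorem integrable_norm_sum_sub_sq {k : ℕ} (T : E →L[ℝ] X) (M : ℝ)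
    (x : EuclideanSpace ℝ (Fin k)) :
    Integrable (fun ω => (‖T (∑ j, x j • ω j)‖ - M) ^ 2)
      (Measure.pi fun _ : Fin k => stdGaussian E) := by
  have h : Integrable (fun z => (‖T z‖ - M) ^ 2)
      ((Measure.pi fun _ : Fin k => stdGaussian E).map (fun ω => ∑ j, x j • ω j)) := by
    rw [map_sum_smul_pi_stdGaussian, integrable_map_measure (by fun_prop) (by fun_prop)]
    exact integrable_norm_sub_const_sq (T.comp (‖x‖ • ContinuousLinearMap.id ℝ E)) M
  exact (integrable_map_measure (by fun_prop) (measurable_sum_smul x).aemeasurable).1 h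

theorem integral_norm_sum_sub_sq_le {k : ℕ} (T : E →L[ℝ] X) (hT : ‖T‖ ≤ 1)
    (x : EuclideanSpace ℝ (Fin k)) (hx : ‖x‖ = 1) :
    ∫ ω, (‖T (∑ j, x j • ω j)‖ - ∫ y, ‖T y‖ ∂(stdGaussian E)) ^ 2
      ∂(Measure.pi fun _ : Fin k => stdGaussian E) ≤ 16 := by
  have h := integral_map (μ := Measure.pi fun _ : Fin k => stdGaussian E)
    (φ := fun ω => ∑ j, x j • ω j) (measurable_sum_smul x).aemeasurable
    (f := fun z => (‖T z‖ - ∫ y, ‖T y‖ ∂(stdGaussian E)) ^ 2) (by fun_prop)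
  rw [← h, map_sum_smul_pi_stdGaussian, hx]
  simpa using integral_norm_sub_integral_sq_le T hT

end

section
variable {X : Type*} [NormedAddCommGroup X] [NormedSpace ℝ X]

theorem exists_linearMap_norm_near_one_on_finset (hX : ¬ FiniteDimensional ℝ X) {k : ℕ}
    (s : Finset (EuclideanSpace ℝ (Fin k))) (hs : ∀ x ∈ s, ‖x‖ = 1) {η : ℝ} (hη : 0 < η) :
    ∃ S : EuclideanSpace ℝ (Fin k) →L[ℝ] X, ∀ x ∈ s, |‖S x‖ - 1| ≤ η := by
  obtain ⟨d, hd⟩ := exists_forall_le_integral_norm_stdGaussian (4 * (s.card + 1) / η)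
  obtain ⟨T, hT, hTe⟩ := exists_linearMap_norm_single_ge hX d
  have hM := hd T hTe
  set M := ∫ y, ‖T y‖ ∂(stdGaussian (EuclideanSpace ℝ (Fin d)))
  have hM0 : 0 < M := lt_of_lt_of_le (by positivity) hM
  obtain ⟨ω, hω⟩ := exists_le_integral
    (μ := Measure.pi fun _ : Fin k => stdGaussian (EuclideanSpace ℝ (Fin d)))
    (f := fun ω => ∑ x ∈ s, (‖T (∑ j, x j • ω j)‖ - M) ^ 2)
    (integrable_finsetSum _ fun x _ => integrable_norm_sum_sub_sq T M x)
  rw [integral_finsetSum _ fun x _ => integrable_norm_sum_sub_sq T M x] at hω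
  have h1 : ∀ x ∈ s, (‖T (∑ j, x j • ω j)‖ - M) ^ 2 ≤ 16 * s.card := fun x hx =>
    calc _ ≤ ∑ x ∈ s, (‖T (∑ j, x j • ω j)‖ - M) ^ 2 :=
          Finset.single_le_sum (f := fun x : EuclideanSpace ℝ (Fin k) =>
            (‖T (∑ j, x j • ω j)‖ - M) ^ 2) (fun _ _ => by positivity) hx
      _ ≤ _ := hω
      _ ≤ ∑ x ∈ s, (16 : ℝ) := Finset.sum_le_sum fun x hx =>
          integral_norm_sum_sub_sq_le T hT x (hs x hx)
      _ = 16 * s.card := by rw [Finset.sum_const, nsmul_eq_mul, mul_comm]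
  let S₀ : EuclideanSpace ℝ (Fin k) →L[ℝ] X :=
    ∑ j, (EuclideanSpace.proj j : EuclideanSpace ℝ (Fin k) →L[ℝ] ℝ).smulRight (T (ω j))
  have hS₀ : ∀ x, S₀ x = T (∑ j, x j • ω j) := fun x => by simp [S₀]
  refine ⟨M⁻¹ • S₀, fun x hx => ?_⟩
  have h2 : |‖T (∑ j, x j • ω j)‖ - M| ≤ 4 * (s.card + 1) :=
    abs_le_of_sq_le_sq (by nlinarith [h1 x hx]) (by positivity)
  rw [smul_apply, hS₀, norm_smul, Real.norm_of_nonneg (by positivity)]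
  have h3 : M⁻¹ * ‖T (∑ j, x j • ω j)‖ - 1 = M⁻¹ * (‖T (∑ j, x j • ω j)‖ - M) := by
    field_simp
  rw [h3, abs_mul, abs_of_pos (by positivity), inv_mul_le_iff₀ hM0]
  rw [div_le_iff₀ hη] at hM
  exact h2.trans hM

theorem exists_euclideanSpace_linearMap_almost_isometry (hX : ¬ FiniteDimensional ℝ X) (k : ℕ)
    {ε : ℝ} (hε : 0 < ε) :
    ∃ S : EuclideanSpace ℝ (Fin k) →L[ℝ] X, ∀ x, |‖S x‖ - ‖x‖| ≤ ε * ‖x‖ := by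
  classical
  set η : ℝ := min 1 (ε / (2 * k + 1))
  have hη : 0 < η := lt_min one_pos (by positivity)
  have hη1 : η ≤ 1 := min_le_left _ _
  have hηε : (2 * k + 1) * η ≤ ε := by
    rw [← le_div_iff₀' (by positivity)]; exact min_le_right _ _
  obtain ⟨t, hts, htf, ht⟩ :=
    (isCompact_sphere (0 : EuclideanSpace ℝ (Fin k)) 1).finite_cover_balls hη
  let s : Finset (EuclideanSpace ℝ (Fin k)) :=
    htf.toFinset ∪ Finset.univ.image fun j => EuclideanSpace.single j 1
  have hs : ∀ x ∈ s, ‖x‖ = 1 := by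
    intro x hx
    rcases Finset.mem_union.1 hx with h | h
    · simpa using hts (htf.mem_toFinset.1 h)
    · obtain ⟨j, -, rfl⟩ := Finset.mem_image.1 h
      simp
  obtain ⟨S, hS⟩ := exists_linearMap_norm_near_one_on_finset hX s hs hη
  have hSb : ∀ v, ‖S v‖ ≤ 2 * k * ‖v‖ := by
    intro v
    have h1 : v = ∑ j, v j • EuclideanSpace.single j (1 : ℝ) := by
      simpa using ((EuclideanSpace.basisFun (Fin k) ℝ).sum_repr v).symm
    conv_lhs => rw [h1, map_sum]
    calc _ ≤ ∑ j, ‖S (v j • EuclideanSpace.single j (1 : ℝ))‖ := norm_sum_le _ _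
      _ ≤ ∑ _j : Fin k, ‖v‖ * 2 := by
        refine Finset.sum_le_sum fun j _ => ?_
        rw [map_smul, norm_smul]
        have h2 := (abs_le.1 (hS (EuclideanSpace.single j 1) (Finset.mem_union_right _
          (Finset.mem_image_of_mem _ (Finset.mem_univ j))))).2
        exact mul_le_mul (PiLp.norm_apply_le v j) (by linarith) (norm_nonneg _) (norm_nonneg _)
      _ = _ := by simp; ring
  have hS1 : ∀ v, ‖v‖ = 1 → |‖S v‖ - 1| ≤ ε := by
    intro v hv
    obtain ⟨x, hx, hvx⟩ := Set.mem_iUnion₂.1 (ht (by simpa using hv))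
    rw [Metric.mem_ball, dist_eq_norm] at hvx
    have h1 := hS x (Finset.mem_union_left _ (htf.mem_toFinset.2 hx))
    have h2 := abs_norm_sub_norm_le (S v) (S x)
    rw [← map_sub] at h2
    have h3 : ‖S (v - x)‖ ≤ 2 * k * η := (hSb _).trans (by gcongr)
    calc |‖S v‖ - 1| ≤ |‖S v‖ - ‖S x‖| + |‖S x‖ - 1| := abs_sub_le _ _ _
      _ ≤ 2 * k * η + η := by linarith
      _ ≤ ε := by linarith
  refine ⟨S, fun x => ?_⟩
  rcases eq_or_ne x 0 with rfl | hx
  · simp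
  have hx0 := norm_pos_iff.2 hx
  have h1 := hS1 (‖x‖⁻¹ • x) (by rw [norm_smul, norm_inv, norm_norm, inv_mul_cancel₀ hx0.ne'])
  rw [map_smul, norm_smul, norm_inv, norm_norm] at h1
  have h2 : ‖S x‖ - ‖x‖ = (‖x‖⁻¹ * ‖S x‖ - 1) * ‖x‖ := by field_simp
  rw [h2, abs_mul, abs_norm]
  gcongr

/-- **Dvoretzky's theorem**: finite-dimensional Euclidean spaces embed almost isometrically into
every infinite-dimensional normed space. -/
theorem exists_linearMap_almost_isometry (hX : ¬ FiniteDimensional ℝ X)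
    (V : Type*) [NormedAddCommGroup V] [InnerProductSpace ℝ V] [FiniteDimensional ℝ V]
    {ε : ℝ} (hε : 0 < ε) :
    ∃ S : V →L[ℝ] X, ∀ x, |‖S x‖ - ‖x‖| ≤ ε * ‖x‖ := by
  obtain ⟨S, hS⟩ := exists_euclideanSpace_linearMap_almost_isometry hX (Module.finrank ℝ V) hε
  let e := (stdOrthonormalBasis ℝ V).repr
  exact ⟨S.comp e.toLinearIsometry.toContinuousLinearMap, fun x => by simpa using hS (e x)⟩

end

end

section
open Filter Topology Metric
variable {V X : Type*} [NormedAddCommGroup V] [InnerProductSpace ℝ V]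
  [NormedAddCommGroup X] [NormedSpace ℝ X]

theorem hasStrictFDerivAt_norm {e : V} (he : e ≠ 0) :
    HasStrictFDerivAt (fun x : V => ‖x‖) (‖e‖⁻¹ • innerSL ℝ e) e := by
  have he' := norm_ne_zero_iff.2 he
  have h := (hasStrictFDerivAt_norm_sq e).sqrt (by positivity)
  simp_rw [Real.sqrt_sq (norm_nonneg _)] at h
  convert h using 1
  ext v
  simp
  field_simp

theorem eventually_abs_norm_sub_norm_sub_inner_le {e : V} (he : e ≠ 0) {c : ℝ} (hc : 0 < c) :
    ∀ᶠ ρ in 𝓝[>] (0 : ℝ), ∀ x ∈ closedBall e ρ, ∀ y ∈ closedBall e ρ,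
      |‖x‖ - ‖y‖ - ‖e‖⁻¹ * inner ℝ e (x - y)| ≤ c * ‖x - y‖ := by
  have h := (hasStrictFDerivAt_norm he).isLittleO.def hc
  obtain ⟨δ, hδ, h⟩ := Metric.eventually_nhds_iff.1 h
  filter_upwards [Ioo_mem_nhdsGT hδ] with ρ hρ x hx y hy
  have h2 := @h (x, y) (by
    rw [Prod.dist_eq]
    exact max_lt ((mem_closedBall.1 hx).trans_lt hρ.2) ((mem_closedBall.1 hy).trans_lt hρ.2))
  simpa using h2

theorem norm_map_sub_norm_map_le {e : V} {c ε r : ℝ} (hr : 0 < r)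
    (hre : 3 * r ≤ ‖e‖) (hε : 0 ≤ ε) (hεr : 2 * ε * ‖e‖ ≤ c * r)
    (h : ∀ x ∈ closedBall e (3 * r), ∀ y ∈ closedBall e (3 * r),
      |‖x‖ - ‖y‖ - ‖e‖⁻¹ * inner ℝ e (x - y)| ≤ c * ‖x - y‖)
    {S : V →L[ℝ] X} (hS : ∀ z, |‖S z‖ - ‖z‖| ≤ ε * ‖z‖) {u v : V}
    (hu : u ∈ closedBall e r) (hv : v ∈ closedBall e r) :
    ‖S v‖ - ‖S u‖ ≤ ‖e‖⁻¹ * inner ℝ e (v - u) + 2 * c * ‖v - u‖ := by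
  rcases eq_or_ne v u with rfl | huv
  · simp
  obtain ⟨w, rfl⟩ : ∃ w, v = u + w := ⟨v - u, by simp⟩
  have hw : 0 < ‖w‖ := by simpa using huv
  rw [add_sub_cancel_left]
  rw [mem_closedBall, dist_eq_norm] at hu hv
  have hw2 : ‖w‖ ≤ 2 * r := by
    have := norm_sub_le (u + w - e) (u - e)
    rw [sub_sub_sub_cancel_right, add_sub_cancel_left] at this
    linarith
  obtain ⟨s, hs⟩ : ∃ s, s = 2 * r / ‖w‖ := ⟨_, rfl⟩
  have hs1 : 1 ≤ s := by rw [hs, one_le_div hw]; exact hw2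
  have hsw : s * ‖w‖ = 2 * r := by rw [hs]; field_simp
  have hsw' : ‖s • w‖ = 2 * r := by
    rw [norm_smul, Real.norm_of_nonneg (by linarith), hsw]
  have hz : ‖u + s • w - e‖ ≤ 3 * r := by
    have := norm_add_le (u - e) (s • w)
    rw [show u + s • w - e = u - e + s • w by abel]
    linarith
  have hle : ∀ z, ‖z - e‖ ≤ 3 * r → ‖z‖ ≤ 2 * ‖e‖ := fun z hz => by
    have := norm_sub_norm_le z e
    linarith
  have hconv : s * ‖S (u + w)‖ ≤ (s - 1) * ‖S u‖ + ‖S (u + s • w)‖ := by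
    have h1 : s • S (u + w) = (s - 1) • S u + S (u + s • w) := by
      simp only [map_add, map_smul]; module
    calc _ = ‖s • S (u + w)‖ := by rw [norm_smul, Real.norm_of_nonneg (by linarith)]
      _ ≤ ‖(s - 1) • S u‖ + ‖S (u + s • w)‖ := h1 ▸ norm_add_le _ _
      _ = _ := by rw [norm_smul, Real.norm_of_nonneg (by linarith)]
  have hu3 : ‖u - e‖ ≤ 3 * r := by linarith
  have h2 := (abs_le.1 (h (u + s • w) (by simpa [dist_eq_norm] using hz) u
    (by simpa [dist_eq_norm] using hu3))).2
  rw [add_sub_cancel_left, inner_smul_right, hsw'] at h2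
  have h3 := (abs_le.1 (hS (u + s • w))).2
  have h4 := (abs_le.1 (hS u)).1
  have h5 := mul_le_mul_of_nonneg_left (hle _ hz) hε
  have h6 := mul_le_mul_of_nonneg_left (hle _ hu3) hε
  have h7 : s * (‖S (u + w)‖ - ‖S u‖) ≤
      s * (‖e‖⁻¹ * inner ℝ e w + 2 * c * ‖w‖) := by
    have : s * (‖e‖⁻¹ * inner ℝ e w + 2 * c * ‖w‖)
      = ‖e‖⁻¹ * (s * inner ℝ e w) + 2 * c * (2 * r) := by rw [← hsw]; ring
    rw [this]
    linarith
  exact le_of_mul_le_mul_left h7 (by linarith)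

theorem eventually_abs_norm_map_sub_norm_map_sub_inner_le (X : Type*) [NormedAddCommGroup X]
    [NormedSpace ℝ X] {e : V} (he : e ≠ 0) {c : ℝ} (hc : 0 < c) :
    ∀ᶠ r in 𝓝[>] (0 : ℝ), ∀ᶠ ε in 𝓝[>] (0 : ℝ), ∀ S : V →L[ℝ] X,
      (∀ z, |‖S z‖ - ‖z‖| ≤ ε * ‖z‖) → ∀ u ∈ closedBall e r, ∀ v ∈ closedBall e r,
      |‖S u‖ - ‖S v‖ - ‖e‖⁻¹ * inner ℝ e (u - v)| ≤ c * ‖u - v‖ := by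
  have he0 := norm_pos_iff.2 he
  have hlim : Tendsto (fun r : ℝ => 3 * r) (𝓝[>] 0) (𝓝[>] 0) := by
    refine tendsto_nhdsWithin_iff.2 ⟨?_, ?_⟩
    · exact ((continuous_const_mul (3 : ℝ)).tendsto' 0 0 (by simp)).mono_left nhdsWithin_le_nhds
    · filter_upwards [self_mem_nhdsWithin] with r hr
      exact Set.mem_Ioi.2 (mul_pos three_pos (Set.mem_Ioi.1 hr))
  filter_upwards [hlim.eventually (eventually_abs_norm_sub_norm_sub_inner_le he (half_pos hc)),
    hlim.eventually (Ioo_mem_nhdsGT he0), self_mem_nhdsWithin] with r h hre hr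
  have hr : 0 < r := hr
  filter_upwards [Ioo_mem_nhdsGT (show 0 < c / 2 * r / (2 * ‖e‖) by positivity)]
    with ε hε S hS u hu v hv
  have hεr : 2 * ε * ‖e‖ ≤ c / 2 * r := by
    have := (lt_div_iff₀ (by positivity)).1 hε.2
    linarith
  have h1 := norm_map_sub_norm_map_le hr hre.2.le hε.1.le hεr h hS hu hv
  have h2 := norm_map_sub_norm_map_le hr hre.2.le hε.1.le hεr h hS hv hu
  rw [norm_sub_rev, ← neg_sub u v, inner_neg_right] at h1
  rw [abs_le]
  constructor <;> linarith

end

section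
open Filter Topology Metric
variable {V : Type*} [NormedAddCommGroup V] [InnerProductSpace ℝ V] {n : ℕ}

theorem AffineIndependent.exists_inner_add_eq [FiniteDimensional ℝ V] {ι : Type*} {p : ι → V}
    (hp : AffineIndependent ℝ p) (c : ι → ℝ) :
    ∃ (h : V) (a : ℝ), ∀ j, inner ℝ h (p j) + a = c j := by
  rcases isEmpty_or_nonempty ι with _ | ⟨⟨i₀⟩⟩
  · exact ⟨0, 0, fun j => isEmptyElim j⟩
  have hli := (affineIndependent_iff_linearIndependent_vsub ℝ p i₀).1 hp
  obtain ⟨g, hg⟩ := LinearMap.exists_leftInverse_of_injective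
    (Finsupp.linearCombination ℝ fun i : {x // x ≠ i₀} => (p i -ᵥ p i₀ : V))
    (LinearMap.ker_eq_bot.2 hli)
  let f : V →ₗ[ℝ] ℝ := (Finsupp.linearCombination ℝ fun i : {x // x ≠ i₀} => c i - c i₀) ∘ₗ g
  have hf : ∀ j, f (p j - p i₀) = c j - c i₀ := by
    intro j
    by_cases hj : j = i₀
    · simp [hj]
    have h := LinearMap.congr_fun hg (Finsupp.single ⟨j, hj⟩ 1)
    simp only [LinearMap.comp_apply, Finsupp.linearCombination_single, one_smul, vsub_eq_sub,
      LinearMap.id_apply] at h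
    simp [f, h]
  let h := (InnerProductSpace.toDual ℝ V).symm (LinearMap.toContinuousLinearMap f)
  have hh : ∀ v, inner ℝ h v = f v := fun v => by simp [h]
  refine ⟨h, c i₀ - inner ℝ h (p i₀), fun j => ?_⟩
  have := hf j
  rw [← hh, inner_sub_right] at this
  linarith

/-- The derivative at `p` of the map sending a tuple of points to its pairwise distances. -/
def pairDistDeriv (p : Fin n → V) : (Fin n → V) →L[ℝ] (PairIdx n → ℝ) :=
  ContinuousLinearMap.pi fun q =>
    (‖p q.1.1 - p q.1.2‖⁻¹ • innerSL ℝ (p q.1.1 - p q.1.2)).comp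
      (ContinuousLinearMap.proj (R := ℝ) (φ := fun _ : Fin n => V) q.1.1 -
        ContinuousLinearMap.proj q.1.2)

theorem pairDistDeriv_apply (p h : Fin n → V) (q : PairIdx n) :
    pairDistDeriv p h q =
      ‖p q.1.1 - p q.1.2‖⁻¹ * inner ℝ (p q.1.1 - p q.1.2) (h q.1.1 - h q.1.2) := by
  simp [pairDistDeriv, inner_sub_left, inner_sub_right, mul_sub]

theorem AffineIndependent.sub_ne_zero_of_pairIdx {p : Fin n → V} (hp : AffineIndependent ℝ p)
    (q : PairIdx n) : p q.1.1 - p q.1.2 ≠ 0 :=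
  sub_ne_zero.2 (hp.injective.ne q.2.ne)

theorem AffineIndependent.surjective_pairDistDeriv [FiniteDimensional ℝ V] {p : Fin n → V}
    (hp : AffineIndependent ℝ p) : Function.Surjective (pairDistDeriv p) := by
  intro t
  choose h a hc using fun i : Fin n => hp.exists_inner_add_eq fun j =>
    if hij : i < j then -(‖p i - p j‖ * t ⟨(i, j), hij⟩) else 0
  refine ⟨h, funext fun q => ?_⟩
  obtain ⟨⟨i, j⟩, hij⟩ := q
  have he := norm_ne_zero_iff.2 (hp.sub_ne_zero_of_pairIdx ⟨(i, j), hij⟩)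
  have h1 := hc i i
  have h2 := hc i j
  have h3 := hc j i
  have h4 := hc j j
  have hij' : i < j := hij
  simp only [hij', hij'.not_gt, lt_irrefl, dite_true, dite_false] at h1 h2 h3 h4 he
  rw [pairDistDeriv_apply, inv_mul_eq_iff_eq_mul₀ he, real_inner_comm, inner_sub_left,
    inner_sub_right, inner_sub_right]
  linarith

theorem AffineIndependent.exists_norm_map_sub_eq [FiniteDimensional ℝ V] {X : Type*}
    [NormedAddCommGroup X] [NormedSpace ℝ X] (hX : ¬ FiniteDimensional ℝ X) {p : Fin n → V}
    (hp : AffineIndependent ℝ p) :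
    ∃ (S : V →L[ℝ] X) (y : Fin n → V), ∀ q : PairIdx n,
      ‖S (y q.1.1 - y q.1.2)‖ = ‖p q.1.1 - p q.1.2‖ := by
  have : CompleteSpace V := FiniteDimensional.complete ℝ V
  have hsurj := LinearMap.range_eq_top.2 hp.surjective_pairDistDeriv
  let g := (pairDistDeriv p).nonlinearRightInverseOfSurjective hsurj
  have hg : 0 < (g.nnnorm : ℝ) :=
    (pairDistDeriv p).nonlinearRightInverseOfSurjective_nnnorm_pos hsurj
  obtain ⟨κ, hκ⟩ : ∃ κ : NNReal, κ = g.nnnorm⁻¹ := ⟨_, rfl⟩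
  have hκ0 : (0 : ℝ) < κ := by rw [hκ]; push_cast; positivity
  obtain ⟨R, hR, hR0⟩ := ((eventually_all.2 fun q : PairIdx n =>
    eventually_abs_norm_map_sub_norm_map_sub_inner_le X (hp.sub_ne_zero_of_pairIdx q)
      (show (0 : ℝ) < κ / 4 by positivity)).and self_mem_nhdsWithin).exists
  have hR0 : 0 < R := hR0
  obtain ⟨ε, ⟨hε, hεq⟩, hε0⟩ := (((eventually_all.2 hR).and (eventually_all.2 fun q : PairIdx n =>
    Ioo_mem_nhdsGT (show (0 : ℝ) < κ / 2 * (R / 2) / ‖p q.1.1 - p q.1.2‖ from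
      div_pos (by positivity) (norm_pos_iff.2 (hp.sub_ne_zero_of_pairIdx q))))).and
      self_mem_nhdsWithin).exists
  obtain ⟨S, hS⟩ := exists_linearMap_almost_isometry hX V (Set.mem_Ioi.1 hε0)
  let Φ : (Fin n → V) → PairIdx n → ℝ := fun y q => ‖S (y q.1.1 - y q.1.2)‖
  have hball : ∀ y ∈ closedBall p (R / 2), ∀ q : PairIdx n,
      y q.1.1 - y q.1.2 ∈ closedBall (p q.1.1 - p q.1.2) R := by
    intro y hy q
    rw [mem_closedBall, dist_eq_norm] at hy ⊢
    have h1 := (norm_le_pi_norm (y - p) q.1.1).trans hy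
    have h2 := (norm_le_pi_norm (y - p) q.1.2).trans hy
    have h3 := norm_sub_le ((y - p) q.1.1) ((y - p) q.1.2)
    rw [sub_sub_sub_comm]
    exact h3.trans (by linarith)
  have hΦ : ApproximatesLinearOn Φ (pairDistDeriv p) (closedBall p (R / 2)) (κ / 2) := by
    intro y hy z hz
    refine (pi_norm_le_iff_of_nonneg (by positivity)).2 fun q => ?_
    have h1 := hε q S hS _ (hball y hy q) _ (hball z hz q)
    have h2 := norm_sub_le ((y - z) q.1.1) ((y - z) q.1.2)
    have h3 := norm_le_pi_norm (y - z) q.1.1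
    have h4 := norm_le_pi_norm (y - z) q.1.2
    rw [sub_sub_sub_comm] at h1
    rw [Pi.sub_apply, Pi.sub_apply, pairDistDeriv_apply, Real.norm_eq_abs]
    refine h1.trans ?_
    calc (κ : ℝ) / 4 * ‖(y - z) q.1.1 - (y - z) q.1.2‖ ≤ κ / 4 * (2 * ‖y - z‖) := by
          gcongr; linarith
      _ = _ := by push_cast; ring
  have ht : (fun q : PairIdx n => ‖p q.1.1 - p q.1.2‖) ∈
      closedBall (Φ p) (((g.nnnorm : ℝ)⁻¹ - (κ / 2 : NNReal)) * (R / 2)) := by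
    have h1 : ((g.nnnorm : ℝ)⁻¹ - (κ / 2 : NNReal)) * (R / 2) = κ / 2 * (R / 2) := by
      rw [hκ]; push_cast; ring
    rw [h1, mem_closedBall, dist_comm, dist_eq_norm]
    refine (pi_norm_le_iff_of_nonneg (by positivity)).2 fun q => ?_
    have h2 := (lt_div_iff₀ (norm_pos_iff.2 (hp.sub_ne_zero_of_pairIdx q))).1 (hεq q).2
    exact (hS _).trans h2.le
  obtain ⟨y, -, hy⟩ := hΦ.surjOn_closedBall_of_nonlinearRightInverse g (by positivity)
    subset_rfl ht
  exact ⟨S, y, fun q => congrFun hy q⟩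

end

/-- Every finite affinely independent subset of `ℓ₂` embeds
isometrically into every infinite-dimensional Banach space. -/
theorem stmt12 (n : ℕ) (x : Fin n → lp (fun _ : ℕ => ℝ) 2) (hx : AffineIndependent ℝ x)
    (X : Type*) [NormedAddCommGroup X] [NormedSpace ℝ X] [CompleteSpace X]
    (hX : ¬ FiniteDimensional ℝ X) :
    ∃ f : Fin n → X, ∀ i j, dist (f i) (f j) = dist (x i) (x j) := by
  let V := Submodule.span ℝ (Set.range x)
  have : FiniteDimensional ℝ V := FiniteDimensional.span_of_finite ℝ (Set.finite_range x)
  let p : Fin n → V := fun i => ⟨x i, Submodule.subset_span (Set.mem_range_self i)⟩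
  have hp : AffineIndependent ℝ p :=
    AffineIndependent.of_comp V.subtype.toAffineMap hx
  obtain ⟨S, y, hS⟩ := hp.exists_norm_map_sub_eq hX
  have h : ∀ i j, i < j → dist (S (y i)) (S (y j)) = dist (x i) (x j) := fun i j hij => by
    rw [dist_eq_norm, ← map_sub, hS ⟨(i, j), hij⟩, dist_eq_norm]
    rfl
  refine ⟨fun i => S (y i), fun i j => ?_⟩
  rcases lt_trichotomy i j with hij | rfl | hij
  · exact h i j hij
  · simp
  · rw [dist_comm, h j i hij, dist_comm]
end
end
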